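/- arXiv:1209.0081 — 2 statements merged into one kernel-verified Lean document; each statement's English description precedes it below -/
import Mathlib

section
/- Let K be a nonarchimedean normed field with ‖(p : K)‖ = (p : ℝ)⁻¹ for a prime p, let ρ be a real number with 0 < ρ < 1, and let a : ℕ → K. If for every integer n ≥ 2 one has ‖a₁‖ > ‖(n : K) · aₙ‖ · ρ^{n-1}, then for every integer n ≥ 2 one has ‖a₁‖ > ‖aₙ‖ · (ρ · (p : ℝ)^{-1/(p-1)})^{n-1}. -/
/-- An integer prime to `p` has norm one in an ultrametric field in which `‖p‖ < 1`. -/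
theorem norm_natCast_eq_one_of_coprime {K : Type*} [NormedField K] [IsUltrametricDist K]
    {p m : ℕ} (hpK : ‖(p : K)‖ < 1) (h : Nat.Coprime p m) : ‖(m : K)‖ = 1 := by
  refine le_antisymm (IsUltrametricDist.norm_natCast_le_one K m) ?_
  by_contra! hm
  have hbez : (p : K) * (p.gcdA m : ℤ) + (m : K) * (p.gcdB m : ℤ) = 1 := by
    have := Nat.gcd_eq_gcd_ab p m
    rw [h.gcd_eq_one] at this
    exact_mod_cast (congrArg (Int.cast : ℤ → K) this).symm
  have hlt : ∀ (x : K) (z : ℤ), ‖x‖ < 1 → ‖x * (z : K)‖ < 1 := fun x z hx => by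
    rw [norm_mul]
    exact (mul_le_of_le_one_right (norm_nonneg x)
      (IsUltrametricDist.norm_intCast_le_one K z)).trans_lt hx
  have hmax := IsUltrametricDist.norm_add_le_max
    ((p : K) * (p.gcdA m : ℤ)) ((m : K) * (p.gcdB m : ℤ))
  rw [hbez, norm_one] at hmax
  exact (max_lt (hlt _ _ hpK) (hlt _ _ hm)).not_ge hmax

/-- If `‖p‖ = p⁻¹`, then `‖n‖` is at least `p ^ (-(n - 1) / (p - 1))` for every `n ≥ 1`. -/
theorem rpow_pow_le_norm_natCast {K : Type*} [NormedField K] [IsUltrametricDist K]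
    {p : ℕ} (hp : p.Prime) (hpK : ‖(p : K)‖ = (p : ℝ)⁻¹) {n : ℕ} (hn : n ≠ 0) :
    ((p : ℝ) ^ (-1 / ((p : ℝ) - 1))) ^ (n - 1) ≤ ‖(n : K)‖ := by
  have hp1 : (1 : ℝ) < p := by exact_mod_cast hp.one_lt
  obtain ⟨k, m, hm, rfl⟩ := Nat.exists_eq_pow_mul_and_not_dvd hn p hp.ne_one
  have hm0 : 1 ≤ m := Nat.one_le_iff_ne_zero.mpr (right_ne_zero_of_mul hn)
  have hnorm : ‖(m : K)‖ = 1 :=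
    norm_natCast_eq_one_of_coprime (hpK ▸ inv_lt_one_of_one_lt₀ hp1)
      ((Nat.Prime.coprime_iff_not_dvd hp).mpr hm)
  have hbern : 1 + (k : ℝ) * ((p : ℝ) - 1) ≤ (p : ℝ) ^ k * m :=
    (one_add_mul_sub_le_pow (by linarith) k).trans
      (le_mul_of_one_le_right (by positivity) (by exact_mod_cast hm0))
  rw [Nat.cast_mul, Nat.cast_pow, norm_mul, norm_pow, hpK, hnorm, mul_one,
    ← Real.rpow_natCast, ← Real.rpow_mul (by positivity), ← Real.rpow_neg_one,
    ← Real.rpow_natCast, ← Real.rpow_mul (by positivity)]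
  refine Real.rpow_le_rpow_of_exponent_le hp1.le ?_
  rw [Nat.cast_sub (Nat.one_le_iff_ne_zero.mpr hn), div_mul_eq_mul_div,
    div_le_iff₀ (by linarith)]
  push_cast
  linarith

/-- **Berkovich's claim.** The étale coefficient bound at radius `ρ` implies the
open-immersion coefficient bound at radius `ρ·p^(-1/(p-1))`. -/
theorem stmt_2 {K : Type*} [NormedField K] [IsUltrametricDist K]
    (p : ℕ) (hp : p.Prime) (hpK : ‖(p : K)‖ = (p : ℝ)⁻¹)
    (ρ : ℝ) (hρ0 : 0 < ρ) (hρ1 : ρ < 1) (a : ℕ → K)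
    (hetale : ∀ n : ℕ, 2 ≤ n → ‖a 1‖ > ‖(n : K) * a n‖ * ρ ^ (n - 1)) :
    ∀ n : ℕ, 2 ≤ n → ‖a 1‖ > ‖a n‖ * (ρ * (p : ℝ) ^ (-1 / ((p : ℝ) - 1))) ^ (n - 1) := by
  intro n hn
  refine lt_of_le_of_lt ?_ (hetale n hn)
  rw [mul_pow, norm_mul]
  calc ‖a n‖ * (ρ ^ (n - 1) * ((p : ℝ) ^ (-1 / ((p : ℝ) - 1))) ^ (n - 1))
      ≤ ‖a n‖ * (ρ ^ (n - 1) * ‖(n : K)‖) := by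
        gcongr
        exact rpow_pow_le_norm_natCast hp hpK (by omega)
    _ = ‖(n : K)‖ * ‖a n‖ * ρ ^ (n - 1) := by ring
end

section
/- Let K be a complete nonarchimedean normed field, let r be a real number with 0 < r, and let a : ℕ → K be such that for every x ∈ K with ‖x‖ < r the series Σ_{n≥0} aₙ xⁿ is summable; define f(x) = Σ'_{n≥0} aₙ xⁿ. Assume that for every real ρ with 0 < ρ < r and every integer n ≥ 2 one has ‖a₁‖ > ‖aₙ‖ · ρ^{n-1}. Then for all x, y ∈ K with ‖x‖ < r and ‖y‖ < r one has ‖f(x) − f(y)‖ = ‖a₁‖ · ‖x − y‖. -/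
theorem IsUltrametricDist.norm_pow_sub_pow_le {K : Type*} [NormedField K] [IsUltrametricDist K]
    {x y : K} {M : ℝ} (hx : ‖x‖ ≤ M) (hy : ‖y‖ ≤ M) (n : ℕ) :
    ‖x ^ n - y ^ n‖ ≤ M ^ (n - 1) * ‖x - y‖ := by
  have hM : 0 ≤ M := (norm_nonneg x).trans hx
  rw [← geom_sum₂_mul, norm_mul]
  gcongr
  refine IsUltrametricDist.norm_sum_le_of_forall_le_of_nonneg (by positivity) fun i hi => ?_
  have hi' : i + (n - 1 - i) = n - 1 := by have := Finset.mem_range.1 hi; omega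
  rw [norm_mul, norm_pow, norm_pow, ← hi', pow_add, hi']
  gcongr

/-- **Condition (2), quantitative form.** The coefficient bound `‖a₁‖ > ‖aₙ‖·ρ^(n-1)` for
all `0 < ρ < r` and `n ≥ 2` makes the power series a scaled isometry on the open disk of
radius `r`. -/
theorem stmt_3 {K : Type*} [NormedField K] [IsUltrametricDist K] [CompleteSpace K]
    (r : ℝ) (hr : 0 < r) (a : ℕ → K)
    (hconv : ∀ x : K, ‖x‖ < r → Summable (fun n : ℕ => a n * x ^ n))
    (f : K → K) (hf : ∀ x : K, f x = ∑' n : ℕ, a n * x ^ n)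
    (hcoef : ∀ ρ : ℝ, 0 < ρ → ρ < r → ∀ n : ℕ, 2 ≤ n → ‖a 1‖ > ‖a n‖ * ρ ^ (n - 1))
    (x y : K) (hx : ‖x‖ < r) (hy : ‖y‖ < r) :
    ‖f x - f y‖ = ‖a 1‖ * ‖x - y‖ := by
  obtain rfl | hxy := eq_or_ne x y
  · simp
  set M := max ‖x‖ ‖y‖ with hMdef
  have hM : 0 ≤ M := (norm_nonneg x).trans (le_max_left _ _)
  obtain ⟨ρ, hMρ, hρr⟩ := exists_between (max_lt hx hy : M < r)
  have hρ : 0 < ρ := hM.trans_lt hMρ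
  have ha : 0 < ‖a 1‖ :=
    (mul_nonneg (norm_nonneg (a 2)) (by positivity)).trans_lt (hcoef ρ hρ hρr 2 le_rfl)
  have hd : 0 < ‖x - y‖ := norm_pos_iff.2 (sub_ne_zero.2 hxy)
  have hq : M / ρ < 1 := (div_lt_one hρ).2 hMρ
  have hterm : ∀ n, ‖a (n + 2) * x ^ (n + 2) - a (n + 2) * y ^ (n + 2)‖ ≤
      ‖a 1‖ * (M / ρ) * ‖x - y‖ := fun n => by
    have hpow := IsUltrametricDist.norm_pow_sub_pow_le (le_max_left ‖x‖ ‖y‖)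
      (le_max_right ‖x‖ ‖y‖) (n + 2)
    calc
      _ = ‖a (n + 2)‖ * ‖x ^ (n + 2) - y ^ (n + 2)‖ := by rw [← mul_sub, norm_mul]
      _ ≤ ‖a (n + 2)‖ * (M ^ (n + 2 - 1) * ‖x - y‖) := by gcongr
      _ = ‖a (n + 2)‖ * ρ ^ (n + 2 - 1) * (M / ρ) ^ (n + 1) * ‖x - y‖ := by
        rw [div_pow]; simp only [Nat.add_succ_sub_one]; field_simp
      _ ≤ ‖a 1‖ * (M / ρ) * ‖x - y‖ := by
        gcongr
        · exact (hcoef ρ hρ hρr (n + 2) (by omega)).le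
        · exact pow_le_of_le_one (by positivity) hq.le (by omega)
  have hdiff : f x - f y = a 1 * (x - y) +
      ∑' n, (a (n + 2) * x ^ (n + 2) - a (n + 2) * y ^ (n + 2)) := by
    have hs := (hconv x hx).sub (hconv y hy)
    rw [hf, hf, ← (hconv x hx).tsum_sub (hconv y hy), ← hs.sum_add_tsum_nat_add 2]
    simp [Finset.sum_range_succ, mul_sub]
  have htail : ‖∑' n, (a (n + 2) * x ^ (n + 2) - a (n + 2) * y ^ (n + 2))‖ <
      ‖a 1 * (x - y)‖ := by
    refine (IsUltrametricDist.norm_tsum_le_of_forall_le hterm).trans_lt ?_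
    rw [norm_mul]
    gcongr
    exact mul_lt_of_lt_one_right ha hq
  rw [hdiff, IsUltrametricDist.norm_add_eq_max_of_norm_ne_norm htail.ne', max_eq_left htail.le,
    norm_mul]
end
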